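/- arXiv:math/0208123 — 2 statements merged into one kernel-verified Lean document; each statement's English description precedes it below -/
import Mathlib

section
/- For every integer m ≥ 0, the series Σ_{n=0}^∞ φ_{n,m} (2/27)^n converges and equals ((2m)! / (m! (m+2)!)) · (9/4)^{m+1}. -/
/-- `φ_{n,m}`: the number of rooted type II triangulations of a disc with `m+2`
boundary vertices and `n` internal vertices. -/
noncomputable def phi (n m : ℕ) : ℝ :=
  2 ^ (n + 1) * ((2 * m + 1).factorial : ℝ) * ((2 * m + 3 * n).factorial : ℝ) /
    (((m.factorial : ℝ)) ^ 2 * ((n.factorial : ℝ)) * (((2 * m + 2 * n + 2).factorial : ℝ)))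

/-- Coefficients of the generalized binomial series `B_3(z)^r`. -/
noncomputable def cA : ℕ → ℕ → ℝ
  | 0, _ => 1
  | _ + 1, 0 => 0
  | n + 1, r + 1 => cA (n + 1) r + cA n (r + 3)
termination_by n r => (n, r)

theorem cA_zero (r : ℕ) : cA 0 r = 1 := by rw [cA]
theorem cA_succ_zero (n : ℕ) : cA (n + 1) 0 = 0 := by rw [cA]
theorem cA_succ_succ (n r : ℕ) : cA (n + 1) (r + 1) = cA (n + 1) r + cA n (r + 3) := by rw [cA]

theorem cA_closed (n : ℕ) : ∀ r : ℕ,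
    cA n (r + 1) * ((n.factorial : ℝ) * ((2 * n + r + 1).factorial : ℝ))
      = (r + 1) * ((3 * n + r).factorial : ℝ) := by
  induction n with
  | zero =>
    intro r
    rw [cA_zero]
    simp [Nat.factorial_succ]
  | succ n ih =>
    intro r
    induction r with
    | zero =>
      have h := ih 2
      rw [cA_succ_succ, cA_succ_zero]
      have e1 : 2 * (n + 1) + 0 + 1 = 2 * n + 2 + 1 := by ring
      have e2 : 3 * (n + 1) + 0 = (3 * n + 2) + 1 := by ring
      rw [e1, e2, Nat.factorial_succ n, Nat.factorial_succ (3 * n + 2)]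
      push_cast at h ⊢
      norm_num at h ⊢
      linear_combination (n + 1 : ℝ) * h
    | succ r ihr =>
      have h := ih (r + 3)
      rw [cA_succ_succ]
      have e1 : 2 * (n + 1) + (r + 1) + 1 = (2 * n + r + 3) + 1 := by ring
      have e2 : 3 * (n + 1) + (r + 1) = (3 * n + r + 3) + 1 := by ring
      have e3 : 2 * (n + 1) + r + 1 = 2 * n + r + 3 := by ring
      have e4 : 3 * (n + 1) + r = 3 * n + r + 3 := by ring
      have e5 : 2 * n + (r + 3) + 1 = (2 * n + r + 3) + 1 := by ring
      have e6 : 3 * n + (r + 3) = 3 * n + r + 3 := by ring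
      have e7 : r + 1 + 3 = r + 3 + 1 := by ring
      rw [e3, e4, Nat.factorial_succ n] at ihr
      rw [e5, e6, Nat.factorial_succ (2 * n + r + 3)] at h
      rw [e1, e2, e7, Nat.factorial_succ n, Nat.factorial_succ (3 * n + r + 3),
        Nat.factorial_succ (2 * n + r + 3)]
      push_cast at h ihr ⊢
      linear_combination (n + 1 : ℝ) * h + (2 * n + r + 4 : ℝ) * ihr

theorem cA_nonneg (n : ℕ) : ∀ r : ℕ, 0 ≤ cA n r := by
  induction n with
  | zero => intro r; rw [cA_zero]; norm_num
  | succ n ih =>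
    intro r
    induction r with
    | zero => rw [cA_succ_zero]
    | succ r ihr => rw [cA_succ_succ]; exact add_nonneg ihr (ih _)

theorem cA_partial_rec (N r : ℕ) :
    ∑ n ∈ Finset.range (N + 1), cA n (r + 1) * (4 / 27 : ℝ) ^ n
      = ∑ n ∈ Finset.range (N + 1), cA n r * (4 / 27 : ℝ) ^ n
        + 4 / 27 * ∑ n ∈ Finset.range N, cA n (r + 3) * (4 / 27 : ℝ) ^ n := by
  rw [Finset.sum_range_succ', Finset.sum_range_succ', Finset.mul_sum]
  simp only [cA_succ_succ, cA_zero, add_mul, Finset.sum_add_distrib]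
  have : ∀ n, cA n (r + 3) * (4 / 27 : ℝ) ^ (n + 1)
      = 4 / 27 * (cA n (r + 3) * (4 / 27 : ℝ) ^ n) := by intro n; ring
  simp only [this]
  ring

theorem cA_partial_le (N : ℕ) : ∀ r : ℕ,
    ∑ n ∈ Finset.range N, cA n r * (4 / 27 : ℝ) ^ n ≤ (3 / 2) ^ r := by
  induction N with
  | zero => intro r; simp; positivity
  | succ N ih =>
    intro r
    induction r with
    | zero =>
      rw [Finset.sum_range_succ']
      simp [cA_succ_zero, cA_zero]
    | succ r ihr =>
      rw [cA_partial_rec]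
      have h := ih (r + 3)
      have e : (3 / 2 : ℝ) ^ (r + 1) = (3 / 2) ^ r + 4 / 27 * (3 / 2) ^ (r + 3) := by ring
      rw [e]; linarith

theorem cA_summable (r : ℕ) : Summable (fun n => cA n r * (4 / 27 : ℝ) ^ n) :=
  summable_of_sum_range_le (fun n => mul_nonneg (cA_nonneg n r) (by positivity))
    (fun N => cA_partial_le N r)

/-- Bounded solutions of the recurrence are constant. -/
theorem bounded_const (G : ℕ → ℝ) (h0 : ∀ r, 0 ≤ G r) (h1 : ∀ r, G r ≤ 1)
    (hrec : ∀ r, 3 * G (r + 1) = 2 * G r + G (r + 3)) : ∀ r, G r = G 0 := by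
  have he : ∀ r, G (r + 2) - 2 * G (r + 1) + G r = (-2) ^ r * (G 2 - 2 * G 1 + G 0) := by
    intro r
    induction r with
    | zero => simp
    | succ r ih =>
      have := hrec r
      have e1 : r + 1 + 2 = r + 3 := rfl
      have e2 : r + 1 + 1 = r + 2 := rfl
      rw [e1, e2, pow_succ]
      linear_combination (-2) * ih - this
  have hz : G 2 - 2 * G 1 + G 0 = 0 := by
    by_contra hne
    have hpos : 0 < |G 2 - 2 * G 1 + G 0| := abs_pos.mpr hne
    obtain ⟨r, hr⟩ := pow_unbounded_of_one_lt (2 / |G 2 - 2 * G 1 + G 0|) (one_lt_two (α := ℝ))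
    rw [div_lt_iff₀ hpos] at hr
    have h := congrArg abs (he r)
    rw [abs_mul, abs_pow, abs_neg, abs_two] at h
    have : |G (r + 2) - 2 * G (r + 1) + G r| ≤ 2 := by
      rw [abs_le]
      constructor <;> linarith [h0 r, h0 (r+1), h0 (r+2), h1 r, h1 (r+1), h1 (r+2)]
    linarith
  have hd : ∀ r, G (r + 1) - G r = G 1 - G 0 := by
    intro r
    induction r with
    | zero => rfl
    | succ r ih =>
      have := he r
      rw [hz, mul_zero] at this
      have e2 : r + 1 + 1 = r + 2 := rfl
      rw [e2]; linarith
  have hl : ∀ r : ℕ, G r = G 0 + r * (G 1 - G 0) := by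
    intro r
    induction r with
    | zero => simp
    | succ r ih =>
      have := hd r
      push_cast
      linarith
  have hdz : G 1 - G 0 = 0 := by
    by_contra hne
    have hpos : 0 < |G 1 - G 0| := abs_pos.mpr hne
    obtain ⟨r, hr⟩ := exists_nat_gt (1 / |G 1 - G 0|)
    rw [div_lt_iff₀ hpos] at hr
    have h : |G r - G 0| = r * |G 1 - G 0| := by
      rw [hl r, add_sub_cancel_left, abs_mul, Nat.abs_cast]
    have : |G r - G 0| ≤ 1 := by
      rw [abs_le]
      constructor <;> linarith [h0 r, h0 0, h1 r, h1 0]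
    linarith
  intro r
  rw [hl r, hdz]; ring

theorem cA_tsum_rec (r : ℕ) :
    ∑' n, cA n (r + 1) * (4 / 27 : ℝ) ^ n
      = ∑' n, cA n r * (4 / 27 : ℝ) ^ n + 4 / 27 * ∑' n, cA n (r + 3) * (4 / 27 : ℝ) ^ n := by
  have a := (cA_summable (r + 1)).hasSum.tendsto_sum_nat.comp (Filter.tendsto_add_atTop_nat 1)
  have b := (cA_summable r).hasSum.tendsto_sum_nat.comp (Filter.tendsto_add_atTop_nat 1)
  have c := (cA_summable (r + 3)).hasSum.tendsto_sum_nat.const_mul (4 / 27 : ℝ)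
  refine tendsto_nhds_unique a ((b.add c).congr ?_)
  intro N
  exact (cA_partial_rec N r).symm

theorem cA_hasSum (r : ℕ) : HasSum (fun n => cA n r * (4 / 27 : ℝ) ^ n) ((3 / 2) ^ r) := by
  have key := bounded_const (fun r => (∑' n, cA n r * (4 / 27 : ℝ) ^ n) * (2 / 3) ^ r)
    (fun r => mul_nonneg (tsum_nonneg fun n => mul_nonneg (cA_nonneg n r) (by positivity))
      (by positivity))
    (fun r => by
      have h : ∑' n, cA n r * (4 / 27 : ℝ) ^ n ≤ (3 / 2) ^ r :=
        Real.tsum_le_of_sum_range_le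
          (fun n => mul_nonneg (cA_nonneg n r) (by positivity)) (fun N => cA_partial_le N r)
      calc _ ≤ (3 / 2 : ℝ) ^ r * (2 / 3) ^ r := by gcongr
        _ = 1 := by rw [← mul_pow]; norm_num)
    (fun r => by
      simp only [cA_tsum_rec r]
      ring) r
  have hz : ∑' n, cA n 0 * (4 / 27 : ℝ) ^ n = 1 := by
    rw [tsum_eq_single 0]
    · simp [cA_zero]
    · intro n hn
      obtain ⟨k, rfl⟩ := Nat.exists_eq_succ_of_ne_zero hn
      simp [cA_succ_zero]
  simp only [hz, pow_zero, mul_one] at key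
  have : ∑' n, cA n r * (4 / 27 : ℝ) ^ n = (3 / 2) ^ r := by
    have e : (2 / 3 : ℝ) ^ r * (3 / 2) ^ r = 1 := by rw [← mul_pow]; norm_num
    linear_combination (3 / 2 : ℝ) ^ r * key - (∑' n, cA n r * (4 / 27 : ℝ) ^ n) * e
  rw [← this]
  exact (cA_summable r).hasSum

theorem phi_eq (n m : ℕ) : phi n m * (2 / 27) ^ n =
    (2 * ((2 * m + 1).factorial : ℝ) / ((m.factorial : ℝ) ^ 2 *
        ((2 * m + 1) * (2 * m + 2) * (2 * m + 4)))) *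
      (3 * (2 * m + 2) * (cA n (2 * m + 1) * (4 / 27 : ℝ) ^ n)
        - 2 * (2 * m + 1) * (cA n (2 * m + 2) * (4 / 27 : ℝ) ^ n)) := by
  have h1 := cA_closed n (2 * m)
  have h2 := cA_closed n (2 * m + 1)
  have e1 : 2 * n + 2 * m + 1 = 2 * m + 2 * n + 1 := by ring
  have e2 : 2 * n + (2 * m + 1) + 1 = (2 * m + 2 * n + 1) + 1 := by ring
  have e3 : 3 * n + 2 * m = 2 * m + 3 * n := by ring
  have e4 : 3 * n + (2 * m + 1) = (2 * m + 3 * n) + 1 := by ring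
  have e5 : 2 * m + 2 * n + 2 = (2 * m + 2 * n + 1) + 1 := by ring
  have e6 : 2 * m + 1 + 1 = 2 * m + 2 := by ring
  rw [e1, e3] at h1
  rw [e2, e4, e6, Nat.factorial_succ (2 * m + 2 * n + 1), Nat.factorial_succ (2 * m + 3 * n)] at h2
  have p : (2 : ℝ) ^ (n + 1) * (2 / 27) ^ n = 2 * (4 / 27) ^ n := by
    rw [pow_succ, mul_right_comm, ← mul_pow]; norm_num; ring
  unfold phi
  rw [e5, Nat.factorial_succ (2 * m + 2 * n + 1)]
  have hn : (n.factorial : ℝ) ≠ 0 := by positivity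
  have hm : (m.factorial : ℝ) ≠ 0 := by positivity
  have hk : ((2 * m + 2 * n + 1).factorial : ℝ) ≠ 0 := by positivity
  have hc : (2 * (m : ℝ) + 2 * n + 1 + 1) ≠ 0 := by positivity
  have q1 : cA n (2 * m + 1) = (2 * m + 1) * ((2 * m + 3 * n).factorial : ℝ) /
      ((n.factorial : ℝ) * ((2 * m + 2 * n + 1).factorial : ℝ)) := by
    rw [eq_div_iff (by positivity)]; push_cast at h1; exact h1
  have q2 : cA n (2 * m + 2) = (2 * m + 2) * ((2 * m + 3 * n + 1) *
        ((2 * m + 3 * n).factorial : ℝ)) /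
      ((n.factorial : ℝ) * ((2 * m + 2 * n + 1 + 1) * ((2 * m + 2 * n + 1).factorial : ℝ))) := by
    rw [eq_div_iff (by positivity)]; push_cast at h2; rw [h2]; ring
  rw [q1, q2]
  push_cast
  have p' : (2 : ℝ) ^ (n + 1) = 2 * (4 / 27) ^ n / (2 / 27) ^ n := by
    rw [eq_div_iff (by positivity)]; exact p
  rw [p']
  generalize (4 / 27 : ℝ) ^ n = x
  have hy : (2 / 27 : ℝ) ^ n ≠ 0 := by positivity
  generalize (2 / 27 : ℝ) ^ n = y at hy
  have a1 : (2 * (m : ℝ) + 1) ≠ 0 := by positivity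
  have a2 : (2 * (m : ℝ) + 2) ≠ 0 := by positivity
  have a3 : (2 * (m : ℝ) + 4) ≠ 0 := by positivity
  field_simp
  ring

/-- `Z_m = Σ_n φ_{n,m} (2/27)^n` converges and equals `((2m)!/(m!(m+2)!)) (9/4)^{m+1}`. -/
theorem Z_at_alpha_inv (m : ℕ) :
    HasSum (fun n : ℕ => phi n m * (2 / 27) ^ n)
      (((2 * m).factorial : ℝ) / ((m.factorial : ℝ) * ((m + 2).factorial : ℝ)) *
        (9 / 4) ^ (m + 1)) := by
  simp only [phi_eq]
  have h := (((cA_hasSum (2 * m + 1)).mul_left (3 * (2 * (m : ℝ) + 2))).sub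
    ((cA_hasSum (2 * m + 2)).mul_left (2 * (2 * (m : ℝ) + 1)))).mul_left
    (2 * ((2 * m + 1).factorial : ℝ) / ((m.factorial : ℝ) ^ 2 *
        ((2 * m + 1) * (2 * m + 2) * (2 * m + 4))))
  refine (congrArg (HasSum _) ?_).mpr h
  have hm : (m.factorial : ℝ) ≠ 0 := by positivity
  have e : (3 / 2 : ℝ) ^ (2 * m) = (9 / 4) ^ m := by rw [pow_mul]; norm_num
  rw [pow_succ _ (2 * m), pow_add _ (2 * m) 2, e, pow_succ, Nat.factorial_succ (2 * m),
    Nat.factorial_succ (m + 1), Nat.factorial_succ m]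
  push_cast
  have a1 : (2 * (m : ℝ) + 1) ≠ 0 := by positivity
  have a2 : (2 * (m : ℝ) + 2) ≠ 0 := by positivity
  have a3 : (2 * (m : ℝ) + 4) ≠ 0 := by positivity
  have a4 : ((m : ℝ) + 1) ≠ 0 := by positivity
  have a5 : ((m : ℝ) + 1 + 1) ≠ 0 := by positivity
  generalize (9 / 4 : ℝ) ^ m = x
  field_simp
  ring
end

section
/- Let (M_t)_{t≥0} be a peeling Markov chain started from any fixed state m₀ ∈ ℕ. Then for every ε > 0, almost surely lim_{n→∞} M_n (log n)^{2+ε} / n^{2/3} = ∞. -/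
open Filter MeasureTheory ProbabilityTheory

/-- `p_{-1,m} = (2m+3)/(3m+3)`, the probability that the peeling step from boundary
size `m` adds a new vertex. -/
noncomputable def pMinusOne (m : ℕ) : ℝ := (2 * (m : ℝ) + 3) / (3 * (m : ℝ) + 3)

/-- `p_{k,m} = 2 (2k-2)! m!² (2m-2k+1)! / ((k-1)!(k+1)!(m-k)!²(2m+1)!)`, the probability
that the peeling step from boundary size `m` swallows `k` boundary vertices (`1 ≤ k ≤ m`). -/
noncomputable def pStep (k m : ℕ) : ℝ :=
  2 * ((2 * k - 2).factorial : ℝ) * ((m.factorial : ℝ)) ^ 2 *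
      ((2 * m - 2 * k + 1).factorial : ℝ) /
    (((k - 1).factorial : ℝ) * ((k + 1).factorial : ℝ) * (((m - k).factorial : ℝ)) ^ 2 *
      ((2 * m + 1).factorial : ℝ))

/-- The one-step transition probability of the peeling Markov chain: from state `m`
the chain moves to `m+1` with probability `p_{-1,m}`, and to `m-k` with probability
`p_{k,m}` for `1 ≤ k ≤ m`. -/
noncomputable def peelTransition (m j : ℕ) : ℝ :=
  if j = m + 1 then pMinusOne m
  else if j < m then pStep (m - j) m
  else 0

/-- `(M_t)_{t≥0}` is a peeling Markov chain w.r.t. the probability measure `P`: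
each `M t` is measurable, and conditionally on any initial trajectory
`(M_0,…,M_t) = (h 0,…,h t)` of positive probability, `M_{t+1} = j` with
probability `peelTransition (h t) j`. -/
def IsPeelingChain {Ω : Type*} [MeasurableSpace Ω] (P : Measure Ω) (M : ℕ → Ω → ℕ) : Prop :=
  (∀ t, Measurable (M t)) ∧
  ∀ (t : ℕ) (h : ℕ → ℕ),
    P {ω | ∀ i ≤ t, M i ω = h i} ≠ 0 →
    ∀ j : ℕ,
      (P[|{ω | ∀ i ≤ t, M i ω = h i}]) {ω | M (t + 1) ω = j} =
        ENNReal.ofReal (peelTransition (h t) j)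

/-- Coefficients of `(1 - z)^α`. -/
noncomputable def cf (α : ℝ) : ℕ → ℝ
  | 0 => 1
  | n + 1 => ((n : ℝ) - α) / ((n : ℝ) + 1) * cf α n

lemma cf_succ (α : ℝ) (n : ℕ) : ((n : ℝ) + 1) * cf α (n + 1) = ((n : ℝ) - α) * cf α n := by
  have : ((n : ℝ) + 1) ≠ 0 := by positivity
  rw [cf]; field_simp

lemma cf_ode (α : ℝ) : (1 - PowerSeries.X) * PowerSeries.derivative ℝ (PowerSeries.mk (cf α))
    = PowerSeries.C (-α) * PowerSeries.mk (cf α) := by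
  ext n
  rw [sub_mul, one_mul, map_sub, PowerSeries.coeff_C_mul, PowerSeries.coeff_mk]
  rw [PowerSeries.coeff_derivative]
  cases n with
  | zero =>
    simp [PowerSeries.coeff_zero_X_mul, cf]
  | succ n =>
    rw [PowerSeries.coeff_succ_X_mul, PowerSeries.coeff_derivative, PowerSeries.coeff_mk,
      PowerSeries.coeff_mk]
    have := cf_succ α (n + 1)
    push_cast at *
    linarith

lemma cf_conv (α β : ℝ) (n : ℕ) :
    ∑ ij ∈ Finset.HasAntidiagonal.antidiagonal n, cf α ij.1 * cf β ij.2 = cf (α + β) n := by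
  have key : (1 - PowerSeries.X) * PowerSeries.derivative ℝ
      (PowerSeries.mk (cf α) * PowerSeries.mk (cf β))
      = PowerSeries.C (-(α + β)) * (PowerSeries.mk (cf α) * PowerSeries.mk (cf β)) := by
    rw [Derivation.leibniz, smul_eq_mul, smul_eq_mul]
    have h1 := cf_ode α
    have h2 := cf_ode β
    have h3 : PowerSeries.C (-(α + β)) = PowerSeries.C (-α) + PowerSeries.C (-β) := by
      rw [← map_add]; congr 1; ring
    rw [h3]
    linear_combination PowerSeries.mk (cf α) * h2 + PowerSeries.mk (cf β) * h1
  have hc : ∀ n, ∑ ij ∈ Finset.HasAntidiagonal.antidiagonal n, cf α ij.1 * cf β ij.2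
      = PowerSeries.coeff n (PowerSeries.mk (cf α) * PowerSeries.mk (cf β)) := by
    intro n; simp [PowerSeries.coeff_mul]
  rw [hc]
  set S := PowerSeries.mk (cf α) * PowerSeries.mk (cf β) with hS
  clear_value S
  have h0 : PowerSeries.coeff 0 S = 1 := by
    rw [← hc]; simp [cf]
  have hrec : ∀ n : ℕ, ((n : ℝ) + 1) * PowerSeries.coeff (n + 1) S
      = ((n : ℝ) - (α + β)) * PowerSeries.coeff n S := by
    intro n
    have := congrArg (PowerSeries.coeff n) key
    rw [sub_mul, one_mul, map_sub, PowerSeries.coeff_C_mul,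
      PowerSeries.coeff_derivative] at this
    cases n with
    | zero =>
      simp [PowerSeries.coeff_zero_X_mul] at this ⊢
      linarith
    | succ n =>
      rw [PowerSeries.coeff_succ_X_mul, PowerSeries.coeff_derivative] at this
      push_cast at *
      linarith
  induction n with
  | zero => rw [h0, cf]
  | succ n ih =>
    have h1 := hrec n
    have h2 := cf_succ (α + β) n
    have : ((n : ℝ) + 1) ≠ 0 := by positivity
    rw [ih, ← h2] at h1
    exact mul_left_cancel₀ this h1

/-- The harmonic function. -/
noncomputable abbrev hh (n : ℕ) : ℝ := cf (-3 / 2) n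

lemma hh_closed (n : ℕ) : hh n = ((2 * n + 1).factorial : ℝ) / ((n.factorial : ℝ) ^ 2 * 4 ^ n) := by
  induction n with
  | zero => simp [hh, cf]
  | succ n ih =>
    rw [hh, cf]
    rw [hh] at ih
    rw [ih, show 2 * (n + 1) + 1 = (2 * n + 1) + 1 + 1 by ring, Nat.factorial_succ (2 * n + 1 + 1),
      Nat.factorial_succ (2 * n + 1), Nat.factorial_succ n]
    have h1 : ((2 * n + 1).factorial : ℝ) ≠ 0 := by positivity
    have h2 : ((n).factorial : ℝ) ≠ 0 := by positivity
    push_cast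
    field_simp
    ring

lemma hh_pos (n : ℕ) : 0 < hh n := by rw [hh_closed]; positivity

lemma cf32_closed (i : ℕ) : cf (3 / 2) (i + 2)
    = 3 * ((2 * i).factorial : ℝ) / ((i.factorial : ℝ) * ((i + 2).factorial : ℝ) * 4 ^ (i + 1)) := by
  induction i with
  | zero => norm_num [cf, Nat.factorial]
  | succ i ih =>
    rw [show i + 1 + 2 = (i + 2) + 1 by ring, cf, ih, Nat.factorial_succ (i + 2),
      show 2 * (i + 1) = 2 * i + 1 + 1 by ring, Nat.factorial_succ (2 * i + 1),
      Nat.factorial_succ (2 * i), Nat.factorial_succ i]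
    have h2 : ((i).factorial : ℝ) ≠ 0 := by positivity
    have h3 : ((i + 2).factorial : ℝ) ≠ 0 := by positivity
    push_cast
    field_simp
    ring

lemma pMinusOne_eq (m : ℕ) : pMinusOne m = 2 / 3 * hh (m + 1) / hh m := by
  have := hh_pos m
  have h1 := cf_succ (-3 / 2) m
  have h2 : hh (m + 1) = ((m : ℝ) + 3 / 2) / (m + 1) * hh m := by
    rw [hh, cf]; ring
  rw [h2, pMinusOne]
  field_simp

lemma pStep_eq (i n : ℕ) : pStep (i + 1) (n + i + 1)
    = 2 / 3 * cf (3 / 2) (i + 2) * hh n / hh (n + i + 1) := by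
  rw [hh_closed, hh_closed, cf32_closed, pStep]
  rw [show 2 * (i + 1) - 2 = 2 * i by omega, show i + 1 - 1 = i by omega,
    show n + i + 1 - (i + 1) = n by omega,
    show 2 * (n + i + 1) - 2 * (i + 1) + 1 = 2 * n + 1 by omega]
  have h1 : ((2 * n + 1).factorial : ℝ) ≠ 0 := by positivity
  have h4 : ((2 * (n + i + 1) + 1).factorial : ℝ) ≠ 0 := by positivity
  have h2 : ((i).factorial : ℝ) ≠ 0 := by positivity
  have h3 : ((i + 2).factorial : ℝ) ≠ 0 := by positivity
  have h5 : ((n + i + 1).factorial : ℝ) ≠ 0 := by positivity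
  have h6 : (n.factorial : ℝ) ≠ 0 := by positivity
  rw [show i + 1 + 1 = i + 2 by ring, show (4 : ℝ) ^ (n + i + 1) = 4 ^ n * 4 ^ (i + 1) by
    rw [← pow_add]; congr 1]
  field_simp

lemma peelTransition_nonneg (m j : ℕ) : 0 ≤ peelTransition m j := by
  unfold peelTransition pMinusOne pStep
  split_ifs <;> positivity

lemma peel_sum (G : ℕ → ℝ) (m : ℕ) :
    ∑ j ∈ Finset.range (m + 2), peelTransition m j * (G j / hh j)
      = G m / hh m + 2 / 3 / hh m *
        ∑ ij ∈ Finset.HasAntidiagonal.antidiagonal (m + 1), cf (3 / 2) ij.1 * G ij.2 := by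
  have hm := hh_pos m
  rw [Finset.Nat.sum_antidiagonal_eq_sum_range_succ (fun i j => cf (3 / 2) i * G j) (m + 1)]
  rw [Finset.sum_range_succ, Finset.sum_range_succ]
  rw [show (m + 1).succ = (m + 1) + 1 from rfl, Finset.sum_range_succ', Finset.sum_range_succ']
  have e1 : peelTransition m m = 0 := by simp [peelTransition]
  have e2 : peelTransition m (m + 1) = pMinusOne m := by simp [peelTransition]
  have e3 : ∑ j ∈ Finset.range m, peelTransition m j * (G j / hh j)
      = ∑ i ∈ Finset.range m, 2 / 3 / hh m * (cf (3 / 2) (i + 1 + 1) * G (m + 1 - (i + 1 + 1))) := by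
    rw [← Finset.sum_range_reflect]
    refine Finset.sum_congr rfl fun i hi => ?_
    have hi := Finset.mem_range.1 hi
    obtain ⟨n, rfl⟩ : ∃ n, m = n + i + 1 := ⟨m - i - 1, by omega⟩
    rw [show n + i + 1 - 1 - i = n by omega, show n + i + 1 + 1 - (i + 1 + 1) = n by omega]
    have : peelTransition (n + i + 1) n = pStep (i + 1) (n + i + 1) := by
      unfold peelTransition
      rw [if_neg (by omega), if_pos (by omega), show n + i + 1 - n = i + 1 by omega]
    rw [this, pStep_eq]
    have := hh_pos n
    field_simp
  have hm1 := hh_pos (m + 1)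
  rw [e1, e2, e3, ← Finset.mul_sum, pMinusOne_eq]
  have c0 : cf (3 / 2) 0 = 1 := rfl
  have c1 : cf (3 / 2) (0 + 1) = -3 / 2 := by simp [cf]; norm_num
  rw [c0, c1, Nat.sub_zero, zero_add, Nat.add_sub_cancel]
  generalize ∑ i ∈ Finset.range m, cf (3 / 2) (i + 1 + 1) * G (m + 1 - (i + 1 + 1)) = T
  generalize hh (m + 1) = a at *
  generalize hh m = b at *
  field_simp
  ring

lemma cf_half (j : ℕ) : cf (-1 / 2) j / hh j = 1 / (2 * (j : ℝ) + 1) := by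
  have key : (2 * (j : ℝ) + 1) * cf (-1 / 2) j = hh j := by
    induction j with
    | zero => simp [hh, cf]
    | succ j ih =>
      rw [hh, cf, cf]
      rw [hh] at ih
      rw [← ih]
      push_cast
      field_simp
      ring
  have := hh_pos j
  rw [div_eq_div_iff this.ne' (by positivity), ← key]; ring

lemma cf_one (m : ℕ) : cf 1 (m + 2) = 0 := by
  induction m with
  | zero => simp [cf]
  | succ m ih => rw [show m + 1 + 2 = (m + 2) + 1 by ring, cf, ih, mul_zero]

lemma peel_super (m : ℕ) :
    ∑ j ∈ Finset.range (m + 2), peelTransition m j * (1 / (2 * (j : ℝ) + 1))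
      ≤ 1 / (2 * (m : ℝ) + 1) := by
  have := peel_sum (cf (-1 / 2)) m
  simp only [cf_half] at this
  rw [this, cf_conv]
  have hm := hh_pos m
  have h1 : cf (3 / 2 + -1 / 2) (m + 1) ≤ 0 := by
    rw [show (3 / 2 + -1 / 2 : ℝ) = 1 by norm_num]
    cases m with
    | zero => simp [cf]
    | succ m =>
      exact (cf_one m).le
  have : 2 / 3 / hh m * cf (3 / 2 + -1 / 2) (m + 1) ≤ 0 :=
    mul_nonpos_of_nonneg_of_nonpos (by positivity) h1
  linarith

/-- The function with unit drift. -/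
noncomputable def FF (j : ℕ) : ℝ := 3 / 4 * (j : ℝ) * (j + 1) / hh j

lemma cf_neg3 (n : ℕ) : cf (-3) n = ((n : ℝ) + 1) * (n + 2) / 2 := by
  induction n with
  | zero => simp [cf]
  | succ n ih => rw [cf, ih]; push_cast; field_simp; ring

lemma peel_drift (m : ℕ) :
    ∑ j ∈ Finset.range (m + 2), peelTransition m j * FF j = FF m + 1 := by
  have := peel_sum (fun j => 3 / 4 * (j : ℝ) * (j + 1)) m
  unfold FF
  rw [this, Finset.Nat.antidiagonal_succ', Finset.sum_cons, Finset.sum_map]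
  have e : ∀ ij : ℕ × ℕ, cf (3 / 2) ij.1 * (3 / 4 * ((ij.2 + 1 : ℕ) : ℝ) * (((ij.2 + 1 : ℕ) : ℝ) + 1))
      = 3 / 2 * (cf (3 / 2) ij.1 * cf (-3) ij.2) := by
    intro ij; rw [cf_neg3]; push_cast; ring
  simp only [Function.Embedding.prodMap, Function.Embedding.coeFn_mk, Prod.map, 
    Function.Embedding.refl_apply, Nat.succ_eq_add_one, e, ← Finset.mul_sum, cf_conv]
  have hm := hh_pos m
  rw [show (3 / 2 + -3 : ℝ) = -3 / 2 by norm_num]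
  change _ + _ * (_ + 3 / 2 * hh m) = _
  generalize hh m = b at *
  simp
  field_simp

lemma hh_lower (n : ℕ) : (n : ℝ) + 1 ≤ hh n ^ 2 := by
  induction n with
  | zero => simp [hh, cf]
  | succ n ih =>
    have h2 : hh (n + 1) = ((n : ℝ) + 3 / 2) / (n + 1) * hh n := by
      rw [hh, cf]; ring
    rw [h2, mul_pow, div_pow, div_mul_eq_mul_div, le_div_iff₀ (by positivity)]
    push_cast
    have : (((n : ℝ) + 3 / 2) ^ 2) * (n + 1) ≤ ((n : ℝ) + 3 / 2) ^ 2 * hh n ^ 2 := by gcongr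
    nlinarith [(Nat.cast_nonneg n : (0 : ℝ) ≤ n)]

lemma FF_nonneg (j : ℕ) : 0 ≤ FF j := by
  have := hh_pos j
  unfold FF; positivity

lemma FF_le (j : ℕ) : FF j ≤ ((j : ℝ) + 1) ^ (3 / 2 : ℝ) := by
  have h := hh_pos j
  have h1 : √((j : ℝ) + 1) ≤ hh j := Real.sqrt_le_iff.2 ⟨h.le, hh_lower j⟩
  have h2 : ((j : ℝ) + 1) ^ (3 / 2 : ℝ) = (j + 1) * √((j : ℝ) + 1) := by
    rw [show (3 / 2 : ℝ) = 1 + 1 / 2 by norm_num, Real.rpow_add (by positivity), Real.rpow_one,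
      ← Real.sqrt_eq_rpow]
  rw [h2, FF, div_le_iff₀ h]
  have h3 : √((j : ℝ) + 1) * √((j : ℝ) + 1) = j + 1 := Real.mul_self_sqrt (by positivity)
  have h4 : ((j : ℝ) + 1) * ((j : ℝ) + 1) ≤ (j + 1) * √((j : ℝ) + 1) * hh j := by
    rw [mul_assoc]
    refine mul_le_mul_of_nonneg_left ?_ (by positivity)
    calc ((j : ℝ) + 1) = √((j : ℝ) + 1) * √((j : ℝ) + 1) := h3.symm
      _ ≤ _ := by gcongr
  nlinarith [(Nat.cast_nonneg j : (0 : ℝ) ≤ j)]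

section Prob

open scoped ENNReal

set_option linter.unusedSectionVars false

variable {Ω : Type*} [MeasurableSpace Ω]

/-- Events determined by the trajectory up to time `t`. -/
def Hist (M : ℕ → Ω → ℕ) (t : ℕ) (A : Set Ω) : Prop :=
  ∀ ω ω', (∀ i ≤ t, M i ω = M i ω') → ω ∈ A → ω' ∈ A

/-- the trajectory up to time `t`. -/
def traj (M : ℕ → Ω → ℕ) (t : ℕ) (ω : Ω) : Fin (t + 1) → ℕ := fun i => M i ω

lemma traj_meas {M : ℕ → Ω → ℕ} (hM : ∀ t, Measurable (M t)) (t : ℕ) :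
    Measurable (traj M t) := measurable_pi_lambda _ fun i => hM i

lemma Hist.eq {M : ℕ → Ω → ℕ} {t : ℕ} {A : Set Ω} (hA : Hist M t A) :
    A = traj M t ⁻¹' (traj M t '' A) := by
  refine subset_antisymm (Set.subset_preimage_image _ _) ?_
  rintro ω ⟨ω', h', e⟩
  refine hA ω' ω (fun i hi => ?_) h'
  exact congrFun e ⟨i, by omega⟩

lemma Hist.meas {M : ℕ → Ω → ℕ} (hM : ∀ t, Measurable (M t)) {t : ℕ} {A : Set Ω}
    (hA : Hist M t A) : MeasurableSet A := by
  rw [hA.eq]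
  exact traj_meas hM t (Set.to_countable _).measurableSet

lemma Hist.compl {M : ℕ → Ω → ℕ} {t : ℕ} {A : Set Ω} (hA : Hist M t A) : Hist M t Aᶜ :=
  fun ω ω' h hω hω' => hω (hA ω' ω (fun i hi => (h i hi).symm) hω')

lemma Hist.inter {M : ℕ → Ω → ℕ} {t : ℕ} {A B : Set Ω} (hA : Hist M t A) (hB : Hist M t B) :
    Hist M t (A ∩ B) :=
  fun ω ω' h hω => ⟨hA ω ω' h hω.1, hB ω ω' h hω.2⟩

/-- transition operator -/
noncomputable def KK (f : ℕ → ℝ≥0∞) (m : ℕ) : ℝ≥0∞ :=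
  ∑' j, ENNReal.ofReal (peelTransition m j) * f j

lemma atom_step (P : Measure Ω) [IsProbabilityMeasure P] (M : ℕ → Ω → ℕ)
    (hM : IsPeelingChain P M) (t : ℕ) (h : ℕ → ℕ) (f : ℕ → ℝ≥0∞) :
    ∫⁻ ω in {ω | ∀ i ≤ t, M i ω = h i}, f (M (t + 1) ω) ∂P
      = ∫⁻ ω in {ω | ∀ i ≤ t, M i ω = h i}, KK f (M t ω) ∂P := by
  set B := {ω | ∀ i ≤ t, M i ω = h i} with hB
  have hBm : MeasurableSet B := by
    refine Hist.meas (t := t) hM.1 ?_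
    intro ω ω' e hω i hi
    rw [← e i hi, hω i hi]
  have r : ∫⁻ ω in B, KK f (M t ω) ∂P = KK f (h t) * P B := by
    rw [← setLIntegral_const]
    refine setLIntegral_congr_fun hBm fun ω hω => ?_
    simp only [hω t le_rfl]
  rw [r]
  by_cases h0 : P B = 0
  · rw [h0, mul_zero, setLIntegral_measure_zero _ _ h0]
  have hc := hM.2 t h h0
  have hl : ∫⁻ ω in B, f (M (t + 1) ω) ∂P
      = ∫⁻ j, f j ∂((P.restrict B).map (M (t + 1))) := by
    rw [lintegral_map (measurable_of_countable f) (hM.1 (t + 1))]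
  rw [hl, lintegral_countable', KK, ← ENNReal.tsum_mul_right]
  refine tsum_congr fun j => ?_
  rw [Measure.map_apply (hM.1 (t + 1)) (measurableSet_singleton j)]
  have hcj := hc j
  have hs : MeasurableSet {ω | M (t + 1) ω = j} := hM.1 (t + 1) (measurableSet_singleton j)
  rw [← hB, cond_apply hBm] at hcj
  rw [← hcj]
  rw [Measure.restrict_apply (hM.1 (t + 1) (measurableSet_singleton j))]
  have : M (t + 1) ⁻¹' {j} ∩ B = B ∩ {ω | M (t + 1) ω = j} := by
    rw [Set.inter_comm]; rfl
  rw [this, mul_comm (f j), mul_right_comm, mul_right_comm (P B)⁻¹,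
    ENNReal.inv_mul_cancel h0 (measure_ne_top _ _), one_mul]

lemma markov_step (P : Measure Ω) [IsProbabilityMeasure P] (M : ℕ → Ω → ℕ)
    (hM : IsPeelingChain P M) (t : ℕ) (A : Set Ω) (hA : Hist M t A) (f : ℕ → ℝ≥0∞) :
    ∫⁻ ω in A, f (M (t + 1) ω) ∂P = ∫⁻ ω in A, KK f (M t ω) ∂P := by
  have hU : A = ⋃ g : traj M t '' A, traj M t ⁻¹' {(g : Fin (t + 1) → ℕ)} := by
    conv_lhs => rw [hA.eq]
    rw [← Set.preimage_iUnion]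
    congr 1
    ext x; simp
  have hms : ∀ g : traj M t '' A, MeasurableSet (traj M t ⁻¹' {(g : Fin (t + 1) → ℕ)}) :=
    fun g => traj_meas hM.1 t (measurableSet_singleton _)
  have hd : Pairwise (Function.onFun Disjoint
      fun g : traj M t '' A => traj M t ⁻¹' {(g : Fin (t + 1) → ℕ)}) := by
    intro g g' hne
    refine Disjoint.preimage _ ?_
    simpa [Subtype.ext_iff] using fun h => hne (Subtype.ext h)
  rw [hU, lintegral_iUnion hms hd, lintegral_iUnion hms hd]
  refine tsum_congr fun g => ?_
  have : traj M t ⁻¹' {(g : Fin (t + 1) → ℕ)}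
      = {ω | ∀ i ≤ t, M i ω = (fun i => if hi : i < t + 1 then g.1 ⟨i, hi⟩ else 0) i} := by
    ext ω
    simp only [Set.mem_preimage, Set.mem_singleton_iff, Set.mem_ofPred_eq]
    constructor
    · intro e i hi
      rw [dif_pos (by omega), ← e]; rfl
    · intro e
      funext i
      have := e i (by omega)
      rw [dif_pos i.2] at this
      exact this
  rw [this]
  exact atom_step P M hM t _ f

lemma KK_ofReal (g : ℕ → ℝ) (hg : ∀ j, 0 ≤ g j) (m : ℕ) :
    KK (fun j => ENNReal.ofReal (g j)) m
      = ENNReal.ofReal (∑ j ∈ Finset.range (m + 2), peelTransition m j * g j) := by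
  rw [KK, tsum_eq_sum (s := Finset.range (m + 2)), ENNReal.ofReal_sum_of_nonneg]
  · refine Finset.sum_congr rfl fun j _ => ?_
    rw [ENNReal.ofReal_mul (peelTransition_nonneg _ _)]
  · intro j _; exact mul_nonneg (peelTransition_nonneg _ _) (hg j)
  · intro j hj
    have : m + 2 ≤ j := by simpa using hj
    have : peelTransition m j = 0 := by
      unfold peelTransition; rw [if_neg (by omega), if_neg (by omega)]
    simp [this]

/-- hit `x` by time `t` -/
def hit (M : ℕ → Ω → ℕ) (x t : ℕ) : Set Ω := {ω | ∃ i ≤ t, x ≤ M i ω}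

/-- hit `x` and then go down to `y`, by time `t` -/
def down (M : ℕ → Ω → ℕ) (x y t : ℕ) : Set Ω :=
  {ω | ∃ k ≤ t, ∃ i ≤ k, x ≤ M i ω ∧ M k ω ≤ y}

lemma hit_hist (M : ℕ → Ω → ℕ) (x t : ℕ) : Hist M t (hit M x t) := by
  rintro ω ω' h ⟨i, hi, hx⟩
  exact ⟨i, hi, by rwa [← h i hi]⟩

lemma down_hist (M : ℕ → Ω → ℕ) (x y t : ℕ) : Hist M t (down M x y t) := by
  rintro ω ω' h ⟨k, hk, i, hi, hx, hy⟩
  exact ⟨k, hk, i, hi, by rwa [← h i (hi.trans hk)], by rwa [← h k hk]⟩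

lemma hit_succ (M : ℕ → Ω → ℕ) (x t : ℕ) (ω : Ω) :
    ω ∈ hit M x (t + 1) ↔ ω ∈ hit M x t ∨ x ≤ M (t + 1) ω := by
  constructor
  · rintro ⟨i, hi, h⟩
    rcases Nat.le_succ_iff.1 hi with hi | rfl
    · exact Or.inl ⟨i, hi, h⟩
    · exact Or.inr h
  · rintro (⟨i, hi, h⟩ | h)
    · exact ⟨i, by omega, h⟩
    · exact ⟨t + 1, le_rfl, h⟩

lemma down_succ (M : ℕ → Ω → ℕ) (x y t : ℕ) (ω : Ω) :
    ω ∈ down M x y (t + 1) ↔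
      ω ∈ down M x y t ∨ (ω ∈ hit M x (t + 1) ∧ M (t + 1) ω ≤ y) := by
  constructor
  · rintro ⟨k, hk, i, hi, h⟩
    rcases Nat.le_succ_iff.1 hk with hk | rfl
    · exact Or.inl ⟨k, hk, i, hi, h⟩
    · exact Or.inr ⟨⟨i, hi, h.1⟩, h.2⟩
  · rintro (⟨k, hk, h⟩ | ⟨⟨i, hi, h⟩, h'⟩)
    · exact ⟨k, by omega, h⟩
    · exact ⟨t + 1, le_rfl, i, hi, h, h'⟩

/-- `1/(2m+1)` -/
noncomputable def gg (m : ℕ) : ℝ≥0∞ := ENNReal.ofReal (1 / (2 * (m : ℝ) + 1))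

lemma gg_anti {a b : ℕ} (h : a ≤ b) : gg b ≤ gg a := by
  unfold gg
  have : (a : ℝ) ≤ b := by exact_mod_cast h
  gcongr

lemma KK_gg (m : ℕ) : KK gg m ≤ gg m := by
  have := KK_ofReal (fun j => 1 / (2 * (j : ℝ) + 1)) (fun j => by positivity) m
  unfold gg
  rw [this]
  exact ENNReal.ofReal_le_ofReal (peel_super m)

lemma lint_split (P : Measure Ω) {A : Set Ω} (hA : MeasurableSet A) (f : Ω → ℝ≥0∞) :
    ∫⁻ ω, f ω ∂P = ∫⁻ ω in A, f ω ∂P + ∫⁻ ω in Aᶜ, f ω ∂P :=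
  (lintegral_add_compl f hA).symm

open Classical in
/-- the supermartingale -/
noncomputable def WW (M : ℕ → Ω → ℕ) (x y t : ℕ) (ω : Ω) : ℝ≥0∞ :=
  if ω ∈ down M x y t then gg y else if ω ∈ hit M x t then gg (M t ω) else gg x

lemma WW_step (P : Measure Ω) [IsProbabilityMeasure P] (M : ℕ → Ω → ℕ)
    (hM : IsPeelingChain P M) (x y : ℕ) (hxy : y < x) (t : ℕ) :
    ∫⁻ ω, WW M x y (t + 1) ω ∂P ≤ ∫⁻ ω, WW M x y t ω ∂P := by
  have hD := down_hist M x y t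
  have hH := hit_hist M x t
  have hDm := hD.meas hM.1
  have hHm := hH.meas hM.1
  set D := down M x y t with hDdef
  set H := hit M x t with hHdef
  rw [lint_split P hDm (WW M x y (t + 1)), lint_split P hDm (WW M x y t)]
  refine add_le_add ?_ ?_
  · refine setLIntegral_mono' hDm fun ω hω => ?_
    unfold WW
    rw [if_pos hω, if_pos ((down_succ M x y t ω).2 (Or.inl hω))]
  rw [lint_split (P.restrict Dᶜ) hHm (WW M x y (t + 1)),
    lint_split (P.restrict Dᶜ) hHm (WW M x y t),
    Measure.restrict_restrict hHm, Measure.restrict_restrict hHm.compl]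
  refine add_le_add ?_ ?_
  · have hi : MeasurableSet (H ∩ Dᶜ) := hHm.inter hDm.compl
    calc ∫⁻ ω in H ∩ Dᶜ, WW M x y (t + 1) ω ∂P
        ≤ ∫⁻ ω in H ∩ Dᶜ, gg (M (t + 1) ω) ∂P := by
          refine setLIntegral_mono' hi fun ω hω => ?_
          unfold WW
          have hh1 : ω ∈ hit M x (t + 1) := (hit_succ M x t ω).2 (Or.inl hω.1)
          split_ifs with h1
          · rcases (down_succ M x y t ω).1 h1 with h2 | h2
            · exact absurd h2 hω.2
            · exact gg_anti h2.2
          · exact le_rfl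
      _ = ∫⁻ ω in H ∩ Dᶜ, KK gg (M t ω) ∂P :=
          markov_step P M hM t _ (hH.inter hD.compl) gg
      _ ≤ ∫⁻ ω in H ∩ Dᶜ, gg (M t ω) ∂P := lintegral_mono fun ω => KK_gg _
      _ = ∫⁻ ω in H ∩ Dᶜ, WW M x y t ω ∂P := by
          refine setLIntegral_congr_fun hi fun ω hω => ?_
          unfold WW
          rw [if_neg hω.2, if_pos hω.1]
  · refine setLIntegral_mono' (hHm.compl.inter hDm.compl) fun ω hω => ?_
    unfold WW
    rw [if_neg hω.2, if_neg hω.1]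
    split_ifs with h1 h2
    · rcases (down_succ M x y t ω).1 h1 with h2 | h2
      · exact absurd h2 hω.2
      · rcases (hit_succ M x t ω).1 h2.1 with h3 | h3
        · exact absurd h3 hω.1
        · omega
    · rcases (hit_succ M x t ω).1 h2 with h3 | h3
      · exact absurd h3 hω.1
      · exact gg_anti h3
    · exact le_rfl

lemma down_bound (P : Measure Ω) [IsProbabilityMeasure P] (M : ℕ → Ω → ℕ)
    (hM : IsPeelingChain P M) (x y : ℕ) (hxy : y < x) (t : ℕ) :
    gg y * P (down M x y t) ≤ gg x := by
  have h1 : ∫⁻ ω, WW M x y t ω ∂P ≤ gg x := by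
    induction t with
    | zero =>
      calc ∫⁻ ω, WW M x y 0 ω ∂P ≤ ∫⁻ _, gg x ∂P := by
            refine lintegral_mono fun ω => ?_
            unfold WW
            split_ifs with h1 h2
            · obtain ⟨k, hk, i, hi, h⟩ := h1
              obtain rfl : k = 0 := by omega
              obtain rfl : i = 0 := by omega
              omega
            · obtain ⟨i, hi, h⟩ := h2
              obtain rfl : i = 0 := by omega
              exact gg_anti h
            · exact le_rfl
        _ = gg x := by simp
    | succ t ih => exact (WW_step P M hM x y hxy t).trans ih
  refine le_trans ?_ h1
  rw [← setLIntegral_const]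
  refine le_trans ?_ (setLIntegral_le_lintegral (down M x y t) _)
  refine setLIntegral_mono' ((down_hist M x y t).meas hM.1) fun ω hω => ?_
  unfold WW
  rw [if_pos hω]

open Classical in
/-- the stopped submartingale -/
noncomputable def VV (M : ℕ → Ω → ℕ) (x t : ℕ) (ω : Ω) : ℝ≥0∞ :=
  if ω ∈ hit M x t then ENNReal.ofReal (((x : ℝ) + 1) ^ (3 / 2 : ℝ))
  else ENNReal.ofReal (FF (M t ω))

lemma FF_le' {j x : ℕ} (h : j ≤ x) : FF j ≤ ((x : ℝ) + 1) ^ (3 / 2 : ℝ) := by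
  refine (FF_le j).trans ?_
  have : (j : ℝ) ≤ x := by exact_mod_cast h
  gcongr

lemma VV_step (P : Measure Ω) [IsProbabilityMeasure P] (M : ℕ → Ω → ℕ)
    (hM : IsPeelingChain P M) (x : ℕ) (t : ℕ) :
    ∫⁻ ω, VV M x t ω ∂P + P (hit M x t)ᶜ ≤ ∫⁻ ω, VV M x (t + 1) ω ∂P := by
  have hH := hit_hist M x t
  have hHm := hH.meas hM.1
  set H := hit M x t with hHdef
  rw [lint_split P hHm (VV M x (t + 1)), lint_split P hHm (VV M x t), add_assoc]
  refine add_le_add ?_ ?_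
  · refine setLIntegral_mono' hHm fun ω hω => ?_
    unfold VV
    rw [if_pos hω, if_pos ((hit_succ M x t ω).2 (Or.inl hω))]
  set g : ℕ → ℝ := fun j => if x ≤ j then ((x : ℝ) + 1) ^ (3 / 2 : ℝ) else FF j with hg
  have hg0 : ∀ j, 0 ≤ g j := by
    intro j
    simp only [hg]
    split_ifs
    · positivity
    · exact FF_nonneg j
  calc ∫⁻ ω in Hᶜ, VV M x t ω ∂P + P Hᶜ
      = ∫⁻ ω in Hᶜ, ENNReal.ofReal (FF (M t ω)) ∂P + ∫⁻ ω in Hᶜ, 1 ∂P := by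
        rw [setLIntegral_one]
        congr 1
        refine setLIntegral_congr_fun hHm.compl fun ω hω => ?_
        unfold VV
        rw [if_neg hω]
    _ = ∫⁻ ω in Hᶜ, (ENNReal.ofReal (FF (M t ω)) + 1) ∂P := by
        rw [lintegral_add_right _ measurable_const]
    _ ≤ ∫⁻ ω in Hᶜ, KK (fun j => ENNReal.ofReal (g j)) (M t ω) ∂P := by
        refine setLIntegral_mono' hHm.compl fun ω hω => ?_
        rw [KK_ofReal g hg0, ← ENNReal.ofReal_one, ← ENNReal.ofReal_add (FF_nonneg _) zero_le_one]
        refine ENNReal.ofReal_le_ofReal ?_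
        rw [← peel_drift]
        have hlt : M t ω < x := by
          by_contra hc
          exact hω ⟨t, le_rfl, by omega⟩
        refine Finset.sum_le_sum fun j hj => ?_
        refine mul_le_mul_of_nonneg_left ?_ (peelTransition_nonneg _ _)
        have := Finset.mem_range.1 hj
        simp only [hg]
        split_ifs with h
        · exact FF_le' (by omega)
        · exact le_rfl
    _ = ∫⁻ ω in Hᶜ, ENNReal.ofReal (g (M (t + 1) ω)) ∂P :=
        (markov_step P M hM t _ hH.compl _).symm
    _ = ∫⁻ ω in Hᶜ, VV M x (t + 1) ω ∂P := by
        refine setLIntegral_congr_fun hHm.compl fun ω hω => ?_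
        simp only [VV, hg]
        by_cases hx : x ≤ M (t + 1) ω
        · rw [if_pos hx, if_pos ((hit_succ M x t ω).2 (Or.inr hx))]
        · rw [if_neg hx, if_neg]
          intro hc
          rcases (hit_succ M x t ω).1 hc with h3 | h3
          · exact hω h3
          · exact hx h3

lemma hit_bound (P : Measure Ω) [IsProbabilityMeasure P] (M : ℕ → Ω → ℕ)
    (hM : IsPeelingChain P M) (x n : ℕ) :
    (n : ℝ≥0∞) * P (hit M x n)ᶜ ≤ ENNReal.ofReal (((x : ℝ) + 1) ^ (3 / 2 : ℝ)) := by
  have h1 : ∀ s ≤ n, (s : ℝ≥0∞) * P (hit M x n)ᶜ ≤ ∫⁻ ω, VV M x s ω ∂P := by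
    intro s
    induction s with
    | zero => simp
    | succ s ih =>
      intro hs
      refine le_trans ?_ (VV_step P M hM x s)
      push_cast
      rw [add_mul, one_mul]
      refine add_le_add (ih (by omega)) (measure_mono ?_)
      refine Set.compl_subset_compl.2 ?_
      rintro ω ⟨i, hi, h⟩
      exact ⟨i, by omega, h⟩
  refine (h1 n le_rfl).trans ?_
  calc ∫⁻ ω, VV M x n ω ∂P ≤ ∫⁻ _, ENNReal.ofReal (((x : ℝ) + 1) ^ (3 / 2 : ℝ)) ∂P := by
        refine lintegral_mono fun ω => ?_
        unfold VV
        split_ifs with h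
        · exact le_rfl
        · refine ENNReal.ofReal_le_ofReal (FF_le' ?_)
          by_contra hc
          exact h ⟨n, le_rfl, by omega⟩
    _ = _ := by simp

lemma main_bound (P : Measure Ω) [IsProbabilityMeasure P] (M : ℕ → Ω → ℕ)
    (hM : IsPeelingChain P M) (x y : ℕ) (hxy : y < x) (n : ℕ) (hn : 0 < n) :
    P {ω | ∃ k ≥ n, M k ω ≤ y} ≤
      ENNReal.ofReal (((x : ℝ) + 1) ^ (3 / 2 : ℝ) / n + (2 * (y : ℝ) + 1) / (2 * x + 1)) := by
  have hn' : (0 : ℝ) < n := by exact_mod_cast hn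
  have h1 : P (hit M x n)ᶜ ≤ ENNReal.ofReal (((x : ℝ) + 1) ^ (3 / 2 : ℝ) / n) := by
    rw [ENNReal.ofReal_div_of_pos hn', ENNReal.ofReal_natCast,
      ENNReal.le_div_iff_mul_le (by simp [hn.ne']) (by simp), mul_comm]
    exact hit_bound P M hM x n
  have h2 : ∀ t, P (down M x y t) ≤ ENNReal.ofReal ((2 * (y : ℝ) + 1) / (2 * x + 1)) := by
    intro t
    have h := down_bound P M hM x y hxy t
    have e : ENNReal.ofReal ((2 * (y : ℝ) + 1) / (2 * x + 1)) = ENNReal.ofReal (2 * (y : ℝ) + 1) * gg x := by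
      rw [gg, ← ENNReal.ofReal_mul (by positivity)]; congr 1; ring
    rw [e]
    calc P (down M x y t) = ENNReal.ofReal (2 * (y : ℝ) + 1) * (gg y * P (down M x y t)) := by
          rw [← mul_assoc, gg, ← ENNReal.ofReal_mul (by positivity),
            mul_one_div_cancel (by positivity), ENNReal.ofReal_one, one_mul]
      _ ≤ _ := by gcongr
  have h3 : P (⋃ t, down M x y t) ≤ ENNReal.ofReal ((2 * (y : ℝ) + 1) / (2 * x + 1)) := by
    have hmono : Monotone (down M x y) := by
      rintro s t hst ω ⟨k, hk, h⟩
      exact ⟨k, hk.trans hst, h⟩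
    rw [hmono.measure_iUnion]
    exact iSup_le h2
  rw [ENNReal.ofReal_add (by positivity) (by positivity)]
  refine le_trans (measure_mono ?_) ((measure_union_le (hit M x n)ᶜ (⋃ t, down M x y t)).trans
    (add_le_add h1 h3))
  rintro ω ⟨k, hk, hy⟩
  by_cases hω : ω ∈ hit M x n
  · obtain ⟨i, hi, hx⟩ := hω
    exact Or.inr (Set.mem_iUnion.2 ⟨k, k, le_rfl, i, le_trans hi hk, hx, hy⟩)
  · exact Or.inl hω

end Prob

lemma scale_bound {Ω : Type*} [MeasurableSpace Ω] (P : Measure Ω)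
    [IsProbabilityMeasure P] (M : ℕ → Ω → ℕ) (hM : IsPeelingChain P M) (j : ℕ) (hj : 2 ≤ j)
    (hY : 1 ≤ Real.exp (2 / 3 * Real.log 2 * j) / (j : ℝ) ^ (2 : ℝ)) :
    P {ω | ∃ k ≥ 2 ^ j, M k ω ≤ ⌊Real.exp (2 / 3 * Real.log 2 * j) / (j : ℝ) ^ (2 : ℝ)⌋₊} ≤
      ENNReal.ofReal (((3 : ℝ) ^ (3 / 2 : ℝ) + 2) * (1 / (j : ℝ) ^ (6 / 5 : ℝ))) := by
  have hj' : (2 : ℝ) ≤ j := by exact_mod_cast hj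
  have hj0 : (0 : ℝ) < j := by linarith
  set L := Real.exp (2 / 3 * Real.log 2 * j) with hL
  have hLpos : 0 < L := Real.exp_pos _
  set Y := L / (j : ℝ) ^ (2 : ℝ) with hYd
  set X := L / (j : ℝ) ^ (4 / 5 : ℝ) with hXd
  have hXY : Y = X * (1 / (j : ℝ) ^ (6 / 5 : ℝ)) := by
    rw [hYd, hXd, show (2 : ℝ) = 4 / 5 + 6 / 5 by norm_num, Real.rpow_add hj0]
    field_simp
  have hlt : Y < X := by
    refine div_lt_div_of_pos_left hLpos (by positivity) ?_
    exact Real.rpow_lt_rpow_of_exponent_lt (by linarith) (by norm_num)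
  have hyY : (⌊Y⌋₊ : ℝ) ≤ Y := Nat.floor_le (by linarith)
  have hXx : X ≤ (⌈X⌉₊ : ℝ) := Nat.le_ceil X
  have hxX : (⌈X⌉₊ : ℝ) < X + 1 := Nat.ceil_lt_add_one (by linarith)
  have hyx : ⌊Y⌋₊ < ⌈X⌉₊ := by
    have : (⌊Y⌋₊ : ℝ) < (⌈X⌉₊ : ℝ) := by linarith
    exact_mod_cast this
  refine (main_bound P M hM ⌈X⌉₊ ⌊Y⌋₊ hyx (2 ^ j) (by positivity)).trans
    (ENNReal.ofReal_le_ofReal ?_)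
  rw [add_mul]
  refine add_le_add ?_ ?_
  · push_cast
    rw [div_le_iff₀ (by positivity)]
    have e1 : L ^ (3 / 2 : ℝ) = 2 ^ j := by
      rw [hL, ← Real.exp_mul, ← Real.exp_log (show (0 : ℝ) < 2 ^ j by positivity), Real.log_pow]
      congr 1; ring
    have e2 : X ^ (3 / 2 : ℝ) = 1 / (j : ℝ) ^ (6 / 5 : ℝ) * 2 ^ j := by
      rw [hXd, Real.div_rpow hLpos.le (by positivity), e1, ← Real.rpow_mul hj0.le]
      norm_num
      ring
    rw [mul_assoc, ← e2, ← Real.mul_rpow (by norm_num) (by linarith)]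
    exact Real.rpow_le_rpow (by positivity) (by linarith) (by norm_num)
  · rw [div_le_iff₀ (by positivity)]
    have hq : 0 < 1 / (j : ℝ) ^ (6 / 5 : ℝ) := by positivity
    calc 2 * (⌊Y⌋₊ : ℝ) + 1 ≤ 4 * Y := by linarith
      _ = 2 * (1 / (j : ℝ) ^ (6 / 5 : ℝ)) * (2 * X) := by rw [hXY]; ring
      _ ≤ 2 * (1 / (j : ℝ) ^ (6 / 5 : ℝ)) * (2 * (⌈X⌉₊ : ℝ) + 1) := by
        gcongr; linarith

/-- For every `ε > 0`, almost surely `M_n (log n)^{2+ε} / n^{2/3} → ∞` for a peeling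
Markov chain started from any fixed state `m₀`. -/
theorem peeling_chain_lower_bound {Ω : Type*} [MeasurableSpace Ω] (P : Measure Ω)
    [IsProbabilityMeasure P] (M : ℕ → Ω → ℕ) (hM : IsPeelingChain P M) (m₀ : ℕ)
    (h0 : ∀ᵐ ω ∂P, M 0 ω = m₀) (ε : ℝ) (hε : 0 < ε) :
    ∀ᵐ ω ∂P, Tendsto
      (fun n : ℕ => (M n ω : ℝ) * Real.log n ^ ((2 : ℝ) + ε) / (n : ℝ) ^ ((2 : ℝ) / 3))
      atTop atTop := by
  have hcf : 0 < Real.log 2 := Real.log_pos (by norm_num)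
  set b : ℝ := 2 / 3 * Real.log 2 with hb
  have hbpos : 0 < b := by positivity
  -- Borel-Cantelli
  have hY : Tendsto (fun j : ℕ => Real.exp (b * j) / (j : ℝ) ^ (2 : ℝ)) atTop atTop :=
    (tendsto_exp_mul_div_rpow_atTop 2 b hbpos).comp tendsto_natCast_atTop_atTop
  obtain ⟨J, hJ⟩ := eventually_atTop.1 ((hY.eventually_ge_atTop 1).and (eventually_ge_atTop 2))
  set E : ℕ → Set Ω := fun j =>
    {ω | ∃ k ≥ 2 ^ j, M k ω ≤ ⌊Real.exp (b * j) / (j : ℝ) ^ (2 : ℝ)⌋₊} with hE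
  have hEb : ∀ j ≥ J, P (E j) ≤ ENNReal.ofReal (((3 : ℝ) ^ (3 / 2 : ℝ) + 2) * (1 / (j : ℝ) ^ (6 / 5 : ℝ))) :=
    fun j hj => scale_bound P M hM j (hJ j hj).2 (hJ j hj).1
  have hsum : Summable fun j : ℕ => ((3 : ℝ) ^ (3 / 2 : ℝ) + 2) * (1 / (j : ℝ) ^ (6 / 5 : ℝ)) :=
    (Real.summable_one_div_nat_rpow.2 (by norm_num)).mul_left _
  have hfin : ∑' j, P (E (j + J)) ≠ ⊤ := by
    have h2 := (summable_nat_add_iff J).2 hsum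
    refine ne_top_of_le_ne_top ?_ (ENNReal.tsum_le_tsum fun j => hEb (j + J) (by omega))
    rw [← ENNReal.ofReal_tsum_of_nonneg (fun j => by positivity) h2]
    exact ENNReal.ofReal_ne_top
  filter_upwards [ae_eventually_notMem hfin] with ω hω
  obtain ⟨J', hJ'⟩ := eventually_atTop.1 hω
  have hlog : Tendsto (fun n : ℕ => Nat.log 2 n) atTop atTop :=
    tendsto_atTop_atTop.2 fun j => ⟨2 ^ j, fun n hn => Nat.le_log_of_pow_le (by norm_num) hn⟩
  have hlim : Tendsto (fun n : ℕ => (Real.log 2 ^ (2 + ε) / Real.exp b) * ((Nat.log 2 n : ℕ) : ℝ) ^ ε)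
      atTop atTop := by
    refine Tendsto.const_mul_atTop (by positivity) ?_
    exact (tendsto_rpow_atTop hε).comp (tendsto_natCast_atTop_atTop.comp hlog)
  refine tendsto_atTop_mono' _ ?_ hlim
  filter_upwards [hlog.eventually_ge_atTop (J' + J + 1), eventually_ge_atTop 1] with n hn hn1
  set j := Nat.log 2 n with hj
  have hnot : ω ∉ E j := by
    have := hJ' (j - J) (by omega)
    rwa [show j - J + J = j by omega] at this
  have hpow1 : 2 ^ j ≤ n := Nat.pow_log_le_self 2 (by omega)
  have hpow2 : n < 2 ^ (j + 1) := Nat.lt_pow_succ_log_self (by norm_num) n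
  have hMk : Real.exp (b * j) / (j : ℝ) ^ (2 : ℝ) ≤ M n ω := by
    have : ¬ (M n ω ≤ ⌊Real.exp (b * j) / (j : ℝ) ^ (2 : ℝ)⌋₊) := fun h => hnot ⟨n, hpow1, h⟩
    exact (Nat.lt_of_floor_lt (not_le.1 this)).le
  have hjpos : (0 : ℝ) < j := by
    have : 0 < j := by omega
    exact_mod_cast this
  have hnpos : (0 : ℝ) < n := by exact_mod_cast hn1
  have hl1 : Real.log 2 * j ≤ Real.log n := by
    rw [mul_comm, ← Real.log_pow]
    exact Real.log_le_log (by positivity) (by exact_mod_cast hpow1)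
  have hl2 : Real.log n ≤ Real.log 2 * (j + 1) := by
    have : Real.log 2 * ((j : ℝ) + 1) = Real.log (2 ^ (j + 1)) := by
      rw [Real.log_pow]; push_cast; ring
    rw [this]
    exact Real.log_le_log hnpos (by exact_mod_cast hpow2.le)
  have hn23 : (n : ℝ) ^ ((2 : ℝ) / 3) ≤ Real.exp b * Real.exp (b * j) := by
    rw [Real.rpow_def_of_pos hnpos, ← Real.exp_add]
    refine Real.exp_le_exp.2 ?_
    rw [hb]
    linarith
  have hlp : Real.log 2 ^ (2 + ε) * ((j : ℝ) ^ (2 : ℝ) * (j : ℝ) ^ ε) ≤ Real.log n ^ (2 + ε) := by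
    rw [← Real.rpow_add hjpos, ← Real.mul_rpow hcf.le hjpos.le]
    exact Real.rpow_le_rpow (by positivity) hl1 (by positivity)
  rw [le_div_iff₀ (by positivity)]
  have hj2 : 0 < (j : ℝ) ^ (2 : ℝ) := by positivity
  calc Real.log 2 ^ (2 + ε) / Real.exp b * (j : ℝ) ^ ε * (n : ℝ) ^ ((2 : ℝ) / 3)
      ≤ Real.log 2 ^ (2 + ε) / Real.exp b * (j : ℝ) ^ ε * (Real.exp b * Real.exp (b * j)) := by
        gcongr
    _ = Real.exp (b * j) / (j : ℝ) ^ (2 : ℝ) *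
        (Real.log 2 ^ (2 + ε) * ((j : ℝ) ^ (2 : ℝ) * (j : ℝ) ^ ε)) := by
        have := Real.exp_pos b
        field_simp
    _ ≤ M n ω * Real.log n ^ (2 + ε) := by gcongr
end
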